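/- Let n ≥ 1 and let S^n(√n) ⊂ ℝ^{n+1} denote the sphere of radius √n centered at the origin. Then the Colding–Minicozzi entropy of S^n(√n) equals its F-functional at center 0 and scale 1; explicitly, sup over x₀ ∈ ℝ^{n+1} and t₀ > 0 of (2π t₀)^{-n/2} ∫_{S^n(√n)} exp(−|y − x₀|²/(2t₀)) dμH^n(y) = (2π)^{-n/2} · n^{n/2} · e^{-n/2} · σ_n, where σ_n = μH^n(S^n) is the n-dimensional Hausdorff measure of the unit sphere in ℝ^{n+1}. -/

import Mathlib

open Real MeasureTheory
lemma numeric (w u : ℝ) (hw : 0 < w) (hu : 1 ≤ u) : 2*u - 1 - u/w - w*u + w ≤ Real.log w := by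
  have h1 := Real.one_sub_inv_le_log_of_pos hw
  have h2 : 2*u - 1 - u/w - w*u + w ≤ 1 - w⁻¹ := by
    have : 1 - w⁻¹ - (2*u - 1 - u/w - w*u + w) = (u-1)*(w-1)^2/w := by
      field_simp; ring
    have h3 : 0 ≤ (u-1)*(w-1)^2/w := by
      have : 0 ≤ u - 1 := by linarith
      positivity
    linarith
  linarith

noncomputable def uu (n s : ℝ) : ℝ := (1 + √(1 + 4*s^2/n))/2
noncomputable def GG (n s : ℝ) : ℝ := n/2 * (2*(uu n s - 1) - Real.log (uu n s))

lemma uu_one_le (n s : ℝ) (hn : 0 < n) : 1 ≤ uu n s := by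
  unfold uu
  have : 1 ≤ √(1 + 4*s^2/n) := by
    rw [Real.one_le_sqrt]; have : 0 ≤ 4*s^2/n := by positivity
    linarith
  linarith

lemma uu_sq (n s : ℝ) (hn : 0 < n) : uu n s ^ 2 - uu n s = s^2/n := by
  unfold uu
  have : √(1 + 4*s^2/n)^2 = 1 + 4*s^2/n := Real.sq_sqrt (by positivity)
  have h : 4*s^2/n = 4*(s^2/n) := by ring
  nlinarith

lemma GG_hasDeriv (n s : ℝ) (hn : 0 < n) : HasDerivAt (GG n) (s / uu n s) s := by
  have hp : 0 < 1 + 4*s^2/n := by positivity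
  have h0 : HasDerivAt (fun s : ℝ => 1 + 4*s^2/n) (8*s/n) s := by
    have := (((hasDerivAt_pow 2 s).const_mul 4).div_const n).const_add 1
    exact this.congr_deriv (by norm_num; ring)
  have h1 : HasDerivAt (uu n) ((8*s/n)/(2*√(1 + 4*s^2/n))/2) s := by
    exact ((h0.sqrt hp.ne').const_add 1).div_const 2
  have hu := uu_one_le n s hn
  have h2 : HasDerivAt (GG n) _ s :=
    (((h1.sub_const 1).const_mul 2).sub (h1.log (by linarith))).const_mul (n/2)
  convert h2 using 1
  have h3 : √(1 + 4*s^2/n) = 2 * uu n s - 1 := by unfold uu; ring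
  have h4 : 0 < 2 * uu n s - 1 := by linarith
  rw [h3]
  have : uu n s ≠ 0 := by linarith
  have h5 := h4.ne'
  generalize uu n s = u at *
  have h6 : n / 2 * (2 * (8 * s / n / (2 * (2 * u - 1)) / 2) - 8 * s / n / (2 * (2 * u - 1)) / 2 / u)
      = (s / u) * ((2*u-1)/(2*u-1)) := by
    field_simp
    ring
  rw [h6, div_self h5, mul_one]

lemma final_ineq (n t r : ℝ) (hn : 0 < n) (ht : 0 < t) :
    t ^ (-n/2) * Real.exp (-(n + r^2)/(2*t)) * Real.exp (GG n (r/t)) ≤ Real.exp (-n/2) := by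
  rw [Real.rpow_def_of_pos ht, ← Real.exp_add, ← Real.exp_add, Real.exp_le_exp]
  set u := uu n (r/t) with hu
  have h1 : 1 ≤ u := uu_one_le _ _ hn
  have h2 : u^2 - u = (r/t)^2/n := uu_sq _ _ hn
  have h3 := numeric (t*u) u (by positivity) h1
  rw [Real.log_mul ht.ne' (by positivity)] at h3
  have h4 : u/(t*u) = 1/t := by field_simp
  have h5 : -(n + r^2)/(2*t) = -n/2*(1/t) - n/2 * (t*(u^2-u)) := by
    rw [h2]; field_simp; ring
  rw [h4] at h3
  rw [h5, GG, ← hu]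
  nlinarith [mul_le_mul_of_nonneg_left h3 (by positivity : 0 ≤ n/2)]

lemma B_le (n s A B C u : ℝ) (hn : 0 < n) (hs : 0 < s) (hA : 0 ≤ A) (hu : 1 ≤ u)
    (hus : u^2 - u = s^2/n) (h1 : s*(n*A - C) = n*B) (h2 : B^2 ≤ A*C) : B * u ≤ A * s := by
  by_contra! h
  have hs2 : s^2 = n*(u^2-u) := by rw [hus]; field_simp
  have h3 : s*B^2 + n*A*B ≤ n*s*A^2 := by nlinarith
  have h0 : 0 ≤ A*s := by positivity
  have h4 : (A*s)^2 < (B*u)^2 := by gcongr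
  have h5 : s*(A*s)^2 < s*(B*u)^2 := by gcongr
  have h6 : n*A*u*(A*s) ≤ n*A*u*(B*u) := by gcongr
  have h7 := mul_le_mul_of_nonneg_right h3 (sq_nonneg u)
  have h8 : s*(A*s)^2 + n*A*u*(A*s) = n*s*A^2*u^2 := by
    have : s*(A*s)^2 + n*A*u*(A*s) = A^2*s*(s^2 + n*u) := by ring
    rw [this, hs2]; ring
  nlinarith

section
variable {n : ℕ}
local notation "EE" => EuclideanSpace ℝ (Fin (n + 1))
local notation "SS" => Metric.sphere (0 : EuclideanSpace ℝ (Fin (n + 1))) (√(n:ℝ))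

lemma integrable_cont (hfin : (μH[(n:ℝ)] : Measure EE) SS < ⊤) (f : EE → ℝ) (hf : Continuous f) :
    IntegrableOn f SS μH[(n:ℝ)] := by
  obtain ⟨C, hC⟩ := (isCompact_sphere (0:EE) (√(n:ℝ))).exists_bound_of_continuousOn hf.continuousOn
  refine IntegrableOn.of_bound hfin hf.aestronglyMeasurable C ?_
  exact (ae_restrict_iff' Metric.isClosed_sphere.measurableSet).2 (Filter.Eventually.of_forall hC)

lemma deriv_int (hfin : (μH[(n:ℝ)] : Measure EE) SS < ⊤) (F F' : ℝ → EE → ℝ)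
    (hF : ∀ τ, Continuous (F τ)) (hF' : Continuous (fun p : ℝ × EE => F' p.1 p.2))
    (h : ∀ τ y, HasDerivAt (fun τ => F τ y) (F' τ y) τ) (τ : ℝ) :
    HasDerivAt (fun τ => ∫ y in SS, F τ y ∂μH[(n:ℝ)]) (∫ y in SS, F' τ y ∂μH[(n:ℝ)]) τ := by
  obtain ⟨C, hC⟩ := ((isCompact_closedBall τ 1).prod
    (isCompact_sphere (0:EE) (√(n:ℝ)))).exists_bound_of_continuousOn hF'.continuousOn
  have hc : Continuous (F' τ) := hF'.comp (by fun_prop : Continuous (fun y : EE => (τ, y)))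
  refine (hasDerivAt_integral_of_dominated_loc_of_deriv_le (bound := fun _ => C)
    (Metric.closedBall_mem_nhds τ one_pos)
    (Filter.Eventually.of_forall fun t => (hF t).aestronglyMeasurable)
    (integrable_cont hfin _ (hF τ)) hc.aestronglyMeasurable ?_
    (integrable_cont hfin _ continuous_const) ?_).2
  · refine (ae_restrict_iff' Metric.isClosed_sphere.measurableSet).2 (Filter.Eventually.of_forall ?_)
    intro y hy t ht
    exact hC (t, y) ⟨ht, hy⟩
  · exact Filter.Eventually.of_forall fun y t _ => h t y

lemma invar (L : EE ≃ₗᵢ[ℝ] EE) (f : EE → ℝ) :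
    ∫ y in SS, f (L y) ∂μH[(n:ℝ)] = ∫ y in SS, f y ∂μH[(n:ℝ)] := by
  have h1 := L.toIsometryEquiv.measurePreserving_hausdorffMeasure (n:ℝ)
  have h2 := h1.setIntegral_preimage_emb L.toIsometryEquiv.toHomeomorph.measurableEmbedding f SS
  have h3 : L.toIsometryEquiv ⁻¹' SS = SS := by
    ext y; simp
  rw [h3] at h2
  exact h2

lemma perp_zero (x p : EE) (hp : inner ℝ p x = 0) :
    ∫ y in SS, inner ℝ p y * Real.exp (inner ℝ x y) ∂μH[(n:ℝ)] = 0 := by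
  set L : EE ≃ₗᵢ[ℝ] EE := (ℝ ∙ p)ᗮ.reflection with hL
  have h1 : L p = -p := Submodule.reflection_orthogonalComplement_singleton_eq_neg p
  have h2 : L x = x := by
    apply Submodule.reflection_mem_subspace_eq_self
    rwa [Submodule.mem_orthogonal_singleton_iff_inner_right]
  have h3 := invar L (fun y => inner ℝ p y * Real.exp (inner ℝ x y))
  have h4 : ∀ y, inner ℝ p (L y) = - inner ℝ p y := fun y => by
    have := L.inner_map_map p y
    rw [h1, inner_neg_left] at this
    linarith
  have h5 : ∀ y, inner ℝ x (L y) = inner ℝ x y := fun y => by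
    have := L.inner_map_map x y
    rwa [h2] at this
  simp only [h4, h5, neg_mul, integral_neg] at h3
  linarith

/-- The moment generating function only depends on the norm. -/
lemma radial (x x' : EE) (h : ‖x‖ = ‖x'‖) :
    ∫ y in SS, Real.exp (inner ℝ x y) ∂μH[(n:ℝ)] = ∫ y in SS, Real.exp (inner ℝ x' y) ∂μH[(n:ℝ)] := by
  set L : EE ≃ₗᵢ[ℝ] EE := (ℝ ∙ (x - x'))ᗮ.reflection with hL
  have h1 : L x = x' := Submodule.reflection_sub h
  rw [← invar L (fun y => Real.exp (inner ℝ x' y))]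
  congr 1; ext y
  rw [← L.inner_map_map x y, h1]

lemma perp_deriv (hfin : (μH[(n:ℝ)] : Measure EE) SS < ⊤) (s : ℝ) (j : Fin (n+1)) (hj : j ≠ 0) :
    ∫ y : EE in SS, (- y 0 + s * y j ^ 2) * Real.exp (s * y 0) ∂μH[(n:ℝ)] = 0 := by
  have h1 : ∀ τ : ℝ, ∫ y : EE in SS, (-τ * y 0 + s * y j) * Real.exp (s * y 0 + τ * y j) ∂μH[(n:ℝ)] = 0 := by
    intro τ
    have := perp_zero (n := n) (EuclideanSpace.single 0 s + EuclideanSpace.single j τ)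
      (EuclideanSpace.single 0 (-τ) + EuclideanSpace.single j s) (by
        simp [inner_add_left, inner_add_right, EuclideanSpace.inner_single_left, hj, hj.symm]
        try ring)
    simpa [inner_add_left, EuclideanSpace.inner_single_left] using this
  have h2 := deriv_int hfin (fun τ y => (-τ * y 0 + s * y j) * Real.exp (s * y 0 + τ * y j))
    (fun τ y => (-y 0) * Real.exp (s * y 0 + τ * y j) +
      (-τ * y 0 + s * y j) * (Real.exp (s * y 0 + τ * y j) * y j))
    (fun τ => by fun_prop) (by fun_prop) (fun τ y => by
      have ha : HasDerivAt (fun τ : ℝ => -τ * y 0 + s * y j) (- y 0) τ := by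
        simpa using ((hasDerivAt_id τ).neg.mul_const (y 0)).add_const (s * y j)
      have hb : HasDerivAt (fun τ : ℝ => s * y 0 + τ * y j) (y j) τ := by
        simpa using ((hasDerivAt_id τ).mul_const (y j)).const_add (s * y 0)
      exact ha.mul hb.exp) 0
  simp only [h1] at h2
  have h3 := h2.unique (hasDerivAt_const 0 0)
  rw [← h3]
  congr 1; ext y
  simp only [zero_mul, add_zero, neg_zero, zero_add]
  ring

lemma ode (hfin : (μH[(n:ℝ)] : Measure EE) SS < ⊤) (s : ℝ) :
    s * (n * (∫ y : EE in SS, Real.exp (s * y 0) ∂μH[(n:ℝ)])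
      - ∫ y : EE in SS, y 0 ^ 2 * Real.exp (s * y 0) ∂μH[(n:ℝ)])
     = n * ∫ y : EE in SS, y 0 * Real.exp (s * y 0) ∂μH[(n:ℝ)] := by
  have h1 : ∑ j : Fin n, ∫ y : EE in SS, (- y 0 + s * y j.succ ^ 2) * Real.exp (s * y 0) ∂μH[(n:ℝ)] = 0 :=
    Finset.sum_eq_zero fun j _ => perp_deriv hfin s j.succ (Fin.succ_ne_zero j)
  rw [← integral_finsetSum _ (fun j _ => integrable_cont hfin _ (by fun_prop))] at h1
  have h2 : ∫ y : EE in SS, ∑ j : Fin n, (- y 0 + s * y j.succ ^ 2) * Real.exp (s * y 0) ∂μH[(n:ℝ)]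
     = ∫ y : EE in SS, (s * (n * Real.exp (s * y 0) - y 0 ^ 2 * Real.exp (s * y 0)) - n * (y 0 * Real.exp (s * y 0))) ∂μH[(n:ℝ)] := by
    refine setIntegral_congr_fun Metric.isClosed_sphere.measurableSet fun y hy => ?_
    have hy' : ‖y‖ ^ 2 = n := by
      rw [mem_sphere_zero_iff_norm.1 hy, Real.sq_sqrt (Nat.cast_nonneg n)]
    rw [EuclideanSpace.real_norm_sq_eq, Fin.sum_univ_succ] at hy'
    simp only
    rw [← Finset.sum_mul, Finset.sum_add_distrib, ← Finset.mul_sum]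
    simp only [Finset.sum_const, Finset.card_univ, Fintype.card_fin, nsmul_eq_mul]
    rw [show ∑ i : Fin n, y i.succ ^ 2 = n - y 0 ^ 2 by linarith]
    ring
  rw [h2, integral_sub (integrable_cont hfin _ (by fun_prop)) (integrable_cont hfin _ (by fun_prop)),
    integral_const_mul, integral_const_mul,
    integral_sub (integrable_cont hfin _ (by fun_prop)) (integrable_cont hfin _ (by fun_prop)),
    integral_const_mul] at h1
  linarith

lemma cs (hfin : (μH[(n:ℝ)] : Measure EE) SS < ⊤) (s : ℝ) :
    (∫ y : EE in SS, y 0 * Real.exp (s * y 0) ∂μH[(n:ℝ)]) ^ 2 ≤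
    (∫ y : EE in SS, Real.exp (s * y 0) ∂μH[(n:ℝ)]) *
      ∫ y : EE in SS, y 0 ^ 2 * Real.exp (s * y 0) ∂μH[(n:ℝ)] := by
  set A := ∫ y : EE in SS, Real.exp (s * y 0) ∂μH[(n:ℝ)]
  set B := ∫ y : EE in SS, y 0 * Real.exp (s * y 0) ∂μH[(n:ℝ)]
  set C := ∫ y : EE in SS, y 0 ^ 2 * Real.exp (s * y 0) ∂μH[(n:ℝ)]
  have key : ∀ c : ℝ, 0 ≤ A * (c * c) + (-2 * B) * c + C := by
    intro c
    have h : 0 ≤ ∫ y : EE in SS, (c - y 0) ^ 2 * Real.exp (s * y 0) ∂μH[(n:ℝ)] :=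
      integral_nonneg fun y => by positivity
    have h2 : ∫ y : EE in SS, (c - y 0) ^ 2 * Real.exp (s * y 0) ∂μH[(n:ℝ)]
      = ∫ y : EE in SS, ((c * c) * Real.exp (s * y 0) + (-2 * c) * (y 0 * Real.exp (s * y 0))
          + y 0 ^ 2 * Real.exp (s * y 0)) ∂μH[(n:ℝ)] := by
      congr 1; ext y; ring
    rw [h2, integral_add (integrable_cont hfin _ (by fun_prop)) (integrable_cont hfin _ (by fun_prop)),
      integral_add (integrable_cont hfin _ (by fun_prop)) (integrable_cont hfin _ (by fun_prop)),
      integral_const_mul, integral_const_mul] at h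
    change 0 ≤ c * c * A + -2 * c * B + C at h
    linarith
  have := discrim_le_zero key
  unfold discrim at this
  nlinarith

lemma mgf_bound (hn : 1 ≤ n) (hfin : (μH[(n:ℝ)] : Measure EE) SS < ⊤) (s : ℝ) (hs : 0 ≤ s) :
    (∫ y : EE in SS, Real.exp (s * y 0) ∂μH[(n:ℝ)]) ≤
      ((μH[(n:ℝ)] : Measure EE) SS).toReal * Real.exp (GG n s) := by
  have hn' : (0:ℝ) < n := by exact_mod_cast hn
  set A : ℝ → ℝ := fun s => ∫ y : EE in SS, Real.exp (s * y 0) ∂μH[(n:ℝ)] with hA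
  have hdA : ∀ s, HasDerivAt A (∫ y : EE in SS, y 0 * Real.exp (s * y 0) ∂μH[(n:ℝ)]) s := by
    intro s
    refine deriv_int hfin (fun s y => Real.exp (s * y 0)) (fun s y => y 0 * Real.exp (s * y 0))
      (fun τ => by fun_prop) (by fun_prop) (fun τ y => ?_) s
    have hb : HasDerivAt (fun τ : ℝ => τ * y 0) (y 0) τ := by
      simpa using (hasDerivAt_id τ).mul_const (y 0)
    rw [mul_comm]
    exact hb.exp
  have hd := fun s => (hdA s).mul ((GG_hasDeriv n s hn').neg.exp)
  have anti : AntitoneOn (A * fun s => Real.exp ((-GG n) s)) (Set.Ici 0) := by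
    refine antitoneOn_of_deriv_nonpos (convex_Ici 0)
      (fun s _ => (hd s).continuousAt.continuousWithinAt)
      (fun s _ => (hd s).differentiableAt.differentiableWithinAt) ?_
    intro s hs
    rw [interior_Ici] at hs
    rw [(hd s).deriv]
    have hu := uu_one_le n s hn'
    have h1 := B_le n s (A s) _ _ (uu n s) hn' hs (integral_nonneg fun y => (Real.exp_pos _).le)
      hu (uu_sq n s hn') (ode hfin s) (cs hfin s)
    set B := ∫ y : EE in SS, y 0 * Real.exp (s * y 0) ∂μH[(n:ℝ)]
    have h2 : B ≤ A s * (s / uu n s) := by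
      rw [← mul_div_assoc, le_div_iff₀ (by linarith)]; exact h1
    have h3 := Real.exp_pos ((-GG n) s)
    nlinarith
  have h := anti Set.self_mem_Ici hs hs
  have hG0 : GG n 0 = 0 := by simp [GG, uu]
  simp only [Pi.mul_apply, Pi.neg_apply, hG0, neg_zero, Real.exp_zero, mul_one, Real.exp_neg] at h
  rw [← div_eq_mul_inv, div_le_iff₀ (Real.exp_pos _)] at h
  have hA0 : A 0 = ((μH[(n:ℝ)] : Measure EE) SS).toReal := by
    simp [hA, Measure.real]
  rw [hA0, inv_one, mul_one] at h
  exact h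

lemma expand (t : ℝ) (ht : 0 < t) (x : EE) :
    ∫ y in SS, Real.exp (-‖y - x‖ ^ 2 / (2 * t)) ∂μH[(n:ℝ)] =
    Real.exp (-(n + ‖x‖^2)/(2*t)) * ∫ y : EE in SS, Real.exp (‖x‖ / t * y 0) ∂μH[(n:ℝ)] := by
  have h0 := radial (n := n) (EuclideanSpace.single 0 (‖x‖ / t)) (t⁻¹ • x) (by
    rw [EuclideanSpace.norm_single, norm_smul, norm_div, norm_norm, norm_inv]; ring)
  simp only [EuclideanSpace.inner_single_left, conj_trivial] at h0
  rw [h0, ← integral_const_mul]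
  refine setIntegral_congr_fun Metric.isClosed_sphere.measurableSet fun y hy => ?_
  have hy' : ‖y‖ ^ 2 = n := by
    rw [mem_sphere_zero_iff_norm.1 hy, Real.sq_sqrt (Nat.cast_nonneg n)]
  rw [← Real.exp_add, norm_sub_sq_real, hy', real_inner_smul_left, real_inner_comm]
  congr 1
  field_simp
  ring

lemma not_fin (hfin : (μH[(n:ℝ)] : Measure EE) SS = ⊤) (t : ℝ) (x : EE) :
    ∫ y in SS, Real.exp (-‖y - x‖ ^ 2 / (2 * t)) ∂μH[(n:ℝ)] = 0 := by
  apply integral_undef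
  intro hi
  obtain ⟨C, hC⟩ := (isCompact_sphere (0:EE) (√(n:ℝ))).exists_bound_of_continuousOn
    (f := fun y => -‖y - x‖ ^ 2 / (2 * t)) (by fun_prop)
  have h : IntegrableOn (fun _ : EE => Real.exp (-C)) SS μH[(n:ℝ)] := by
    refine Integrable.mono' hi (by fun_prop) ?_
    refine (ae_restrict_iff' Metric.isClosed_sphere.measurableSet).2 (Filter.Eventually.of_forall ?_)
    intro y hy
    rw [Real.norm_of_nonneg (Real.exp_pos _).le, Real.exp_le_exp]
    have := hC y hy
    rw [Real.norm_eq_abs] at this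
    exact (abs_le.1 this).1
  rw [integrableOn_const_iff] at h
  simp [hfin, Real.exp_ne_zero] at h

lemma scale (hn : 1 ≤ n) : (μH[(n:ℝ)] : Measure EE) SS =
    ENNReal.ofReal ((n:ℝ) ^ ((n:ℝ)/2)) * (μH[(n:ℝ)] : Measure EE) (Metric.sphere 0 1) := by
  have hn' : (0:ℝ) < n := by exact_mod_cast hn
  have hs : 0 < √(n:ℝ) := Real.sqrt_pos.2 hn'
  have h1 := Measure.hausdorffMeasure_smul₀ (𝕜 := ℝ) (E := EE) (d := (n:ℝ)) hn'.le hs.ne' (Metric.sphere 0 1)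
  rw [smul_sphere' hs.ne', smul_zero, Real.norm_of_nonneg hs.le, mul_one] at h1
  rw [h1, ENNReal.smul_def, smul_eq_mul]
  congr 1
  rw [← ENNReal.ofReal_coe_nnreal]
  congr 1
  rw [NNReal.coe_rpow, coe_nnnorm, Real.norm_of_nonneg hs.le, Real.sqrt_eq_rpow, ← Real.rpow_mul hn'.le]
  congr 1; ring
end


/-- The Colding–Minicozzi entropy of the self-shrinking sphere `Sⁿ(√n) ⊂ ℝⁿ⁺¹` is
attained by the `F`-functional at center `0`, scale `1`, and equals
`(2π)^{-n/2} n^{n/2} e^{-n/2} σ_n`, where `σ_n` is the area of the unit `n`-sphere. -/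
theorem entropy_of_round_sphere_self_shrinker (n : ℕ) (hn : 1 ≤ n) :
    (⨆ (x₀ : EuclideanSpace ℝ (Fin (n + 1))) (t₀ : {t : ℝ // 0 < t}),
        (2 * Real.pi * (t₀ : ℝ)) ^ (-(n : ℝ) / 2) *
          ∫ y in Metric.sphere (0 : EuclideanSpace ℝ (Fin (n + 1))) (Real.sqrt n),
            Real.exp (-‖y - x₀‖ ^ 2 / (2 * (t₀ : ℝ))) ∂(μH[(n : ℝ)])) =
      (2 * Real.pi) ^ (-(n : ℝ) / 2) * (n : ℝ) ^ ((n : ℝ) / 2) *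
        Real.exp (-(n : ℝ) / 2) *
        (μH[(n : ℝ)] (Metric.sphere (0 : EuclideanSpace ℝ (Fin (n + 1))) 1)).toReal := by
  have hn' : (0:ℝ) < n := by exact_mod_cast hn
  have hpow : 0 < (n:ℝ) ^ ((n:ℝ)/2) := by positivity
  have hsc := scale hn
  by_cases hfin : (μH[(n:ℝ)] : Measure (EuclideanSpace ℝ (Fin (n + 1)))) (Metric.sphere 0 (√(n:ℝ))) = ⊤
  · have h1 : (μH[(n:ℝ)] : Measure (EuclideanSpace ℝ (Fin (n + 1)))) (Metric.sphere 0 1) = ⊤ := by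
      rw [hfin] at hsc
      by_contra h
      exact (ENNReal.mul_lt_top ENNReal.ofReal_lt_top (lt_top_iff_ne_top.2 h)).ne hsc.symm
    simp only [not_fin hfin, h1]
    simp
  have hlt := lt_top_iff_ne_top.2 hfin
  set K := (2 * Real.pi) ^ (-(n : ℝ) / 2) * (n : ℝ) ^ ((n : ℝ) / 2) *
        Real.exp (-(n : ℝ) / 2) *
        (μH[(n : ℝ)] (Metric.sphere (0 : EuclideanSpace ℝ (Fin (n + 1))) 1)).toReal with hK
  have hK' : K = (2 * Real.pi) ^ (-(n : ℝ) / 2) * (Real.exp (-(n : ℝ) / 2) *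
        (μH[(n : ℝ)] (Metric.sphere (0 : EuclideanSpace ℝ (Fin (n + 1))) (√(n:ℝ)))).toReal) := by
    rw [hsc, ENNReal.toReal_mul, ENNReal.toReal_ofReal hpow.le, hK]; ring
  have hle : ∀ (x₀ : EuclideanSpace ℝ (Fin (n + 1))) (t₀ : {t : ℝ // 0 < t}),
      (2 * Real.pi * (t₀ : ℝ)) ^ (-(n : ℝ) / 2) *
          ∫ y in Metric.sphere (0 : EuclideanSpace ℝ (Fin (n + 1))) (Real.sqrt n),
            Real.exp (-‖y - x₀‖ ^ 2 / (2 * (t₀ : ℝ))) ∂(μH[(n : ℝ)]) ≤ K := by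
    rintro x ⟨t, ht⟩
    simp only
    have h1 := mgf_bound hn hlt (‖x‖/t) (by positivity)
    have h2 := final_ineq n t ‖x‖ hn' ht
    rw [expand t ht x, Real.mul_rpow (by positivity) ht.le, hK', mul_assoc]
    refine mul_le_mul_of_nonneg_left ?_ (by positivity)
    set M := (μH[(n : ℝ)] (Metric.sphere (0 : EuclideanSpace ℝ (Fin (n + 1))) (√(n:ℝ)))).toReal
    have hM : 0 ≤ M := ENNReal.toReal_nonneg
    calc _ ≤ t ^ (-(n:ℝ)/2) * (Real.exp (-(n + ‖x‖^2)/(2*t)) * (M * Real.exp (GG n (‖x‖/t)))) := by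
          gcongr
      _ = (t ^ (-(n:ℝ)/2) * Real.exp (-(n + ‖x‖^2)/(2*t)) * Real.exp (GG n (‖x‖/t))) * M := by ring
      _ ≤ _ := by gcongr
  haveI : Nonempty {t : ℝ // 0 < t} := ⟨⟨1, one_pos⟩⟩
  apply le_antisymm
  · exact ciSup_le fun x => ciSup_le fun t => hle x t
  · have hb1 : ∀ x₀ : EuclideanSpace ℝ (Fin (n + 1)), BddAbove (Set.range fun t₀ : {t : ℝ // 0 < t} =>
      (2 * Real.pi * (t₀ : ℝ)) ^ (-(n : ℝ) / 2) *
          ∫ y in Metric.sphere (0 : EuclideanSpace ℝ (Fin (n + 1))) (Real.sqrt n),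
            Real.exp (-‖y - x₀‖ ^ 2 / (2 * (t₀ : ℝ))) ∂(μH[(n : ℝ)])) := fun x =>
      ⟨K, by rintro _ ⟨t, rfl⟩; exact hle x t⟩
    refine le_trans ?_ (le_ciSup ⟨K, by rintro _ ⟨x, rfl⟩; exact ciSup_le fun t => hle x t⟩ 0)
    refine le_trans ?_ (le_ciSup (hb1 0) ⟨1, one_pos⟩)
    simp only
    rw [expand 1 one_pos 0, hK']
    simp [Measure.real]
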